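/- Let Ω = {v ∈ ℝ² : W(v) ≠ 0} and f = log(Re W) on Ω. Set V₁ = E₁ − E₂, V₂ = E₂ − E₃, V₃ = E₃ − E₁. Then for every v ∈ Ω: (i) each of the three numbers z₁z₂/(z₁−z₂)², z₂z₃/(z₂−z₃)², z₃z₁/(z₃−z₁)² (evaluated at v) is a real number; and (ii) for all u, w ∈ ℝ², Hess f(v)(u,w) = 2·[ (z₁z₂/(z₁−z₂)²)·⟨V₁,u⟩⟨V₁,w⟩ + (z₂z₃/(z₂−z₃)²)·⟨V₂,u⟩⟨V₂,w⟩ + (z₃z₁/(z₃−z₁)²)·⟨V₃,u⟩⟨V₃,w⟩ ] (the coefficients being interpreted via their real values). -/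

import Mathlib

open scoped RealInnerProductSpace
noncomputable section

/-- The plane `ℝ²`. -/
abbrev Plane := EuclideanSpace ℝ (Fin 2)

/-- The three unit vectors `E₁ = (1,0)`, `E₂ = (−1/2, √3/2)`, `E₃ = (−1/2, −√3/2)`. -/
def E : Fin 3 → Plane := fun k =>
  (WithLp.equiv 2 (Fin 2 → ℝ)).symm
    (![![1, 0], ![-(1/2), Real.sqrt 3 / 2], ![-(1/2), -(Real.sqrt 3 / 2)]] k)

/-- `z_k(v) = exp(i⟨v, E_k⟩)`. -/
def z (k : Fin 3) (v : Plane) : ℂ := Complex.exp (Complex.I * ((⟪v, E k⟫ : ℝ) : ℂ))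

/-- `W = −((z₁−z₂)(z₂−z₃)(z₃−z₁))²`. -/
def W (v : Plane) : ℂ :=
  -((z 0 v - z 1 v) * (z 1 v - z 2 v) * (z 2 v - z 0 v)) ^ 2

/-- The open set `Ω = {W ≠ 0}`. -/
def Omega : Set Plane := {v | W v ≠ 0}

/-- `f = log (Re W)`. -/
def fdel (v : Plane) : ℝ := Real.log (W v).re

/-- The Hessian (second Fréchet derivative) of a scalar function, as a bilinear form. -/
def Hess (g : Plane → ℝ) (v u w : Plane) : ℝ := fderiv ℝ (fderiv ℝ g) v u w

/-- `V₁ = E₁ − E₂`, `V₂ = E₂ − E₃`, `V₃ = E₃ − E₁`. -/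
def V : Fin 3 → Plane := ![E 0 - E 1, E 1 - E 2, E 2 - E 0]

/-- The coefficients `z_p z_q/(z_p − z_q)²` for the three pairs. -/
def cdel : Fin 3 → Plane → ℂ :=
  ![fun v => z 0 v * z 1 v / (z 0 v - z 1 v) ^ 2,
    fun v => z 1 v * z 2 v / (z 1 v - z 2 v) ^ 2,
    fun v => z 2 v * z 0 v / (z 2 v - z 0 v) ^ 2]

theorem exp_I_mul_sub_exp_I_mul (a b : ℂ) :
    Complex.exp (Complex.I * a) - Complex.exp (Complex.I * b) =
      2 * Complex.I * Complex.sin ((a - b) / 2) * Complex.exp (Complex.I * ((a + b) / 2)) := by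
  have ha : Complex.exp (Complex.I * a) =
      Complex.exp ((a - b) / 2 * Complex.I) * Complex.exp (Complex.I * ((a + b) / 2)) := by
    rw [← Complex.exp_add]; ring_nf
  have hb : Complex.exp (Complex.I * b) =
      Complex.exp (-((a - b) / 2) * Complex.I) * Complex.exp (Complex.I * ((a + b) / 2)) := by
    rw [← Complex.exp_add]; ring_nf
  rw [ha, hb, Complex.sin]
  linear_combination (-(Complex.exp (-((a - b) / 2) * Complex.I) -
    Complex.exp ((a - b) / 2 * Complex.I)) * Complex.exp (Complex.I * ((a + b) / 2))) *
    Complex.I_sq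

/-- The sine of half the phase difference along `V k`. -/
def halfSin (k : Fin 3) (v : Plane) : ℝ := Real.sin (⟪V k, v⟫ / 2)

theorem z_sub_z (p q k : Fin 3) (hk : V k = E p - E q) (v : Plane) :
    z p v - z q v = 2 * Complex.I * (halfSin k v : ℂ) *
      Complex.exp (Complex.I * (((⟪v, E p⟫ : ℝ) + (⟪v, E q⟫ : ℝ)) / 2 : ℂ)) := by
  rw [z, z, exp_I_mul_sub_exp_I_mul, halfSin, hk, real_inner_comm v (E p - E q), inner_sub_right]
  push_cast
  rfl

theorem z_mul_z_div_sq (p q k : Fin 3) (hk : V k = E p - E q) (v : Plane) :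
    z p v * z q v / (z p v - z q v) ^ 2 = ((-1 / (4 * halfSin k v ^ 2) : ℝ) : ℂ) := by
  have h : z p v * z q v =
      Complex.exp (Complex.I * (((⟪v, E p⟫ : ℝ) + (⟪v, E q⟫ : ℝ)) / 2 : ℂ)) ^ 2 := by
    rw [z, z, ← Complex.exp_add, ← Complex.exp_nat_mul]
    push_cast
    ring_nf
  rw [z_sub_z p q k hk, h, mul_pow, ← div_div, div_right_comm,
    div_self (pow_ne_zero 2 (Complex.exp_ne_zero _)), mul_pow, mul_pow, Complex.I_sq]
  push_cast
  rw [neg_div, ← div_neg]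
  ring

theorem cdel_eq (k : Fin 3) (v : Plane) :
    cdel k v = ((-1 / (4 * halfSin k v ^ 2) : ℝ) : ℂ) := by
  fin_cases k
  · exact z_mul_z_div_sq 0 1 0 rfl v
  · exact z_mul_z_div_sq 1 2 1 rfl v
  · exact z_mul_z_div_sq 2 0 2 rfl v

theorem E_sum : E 0 + E 1 + E 2 = 0 := by
  ext i
  fin_cases i
  · simp [E]; norm_num
  · simp [E]

theorem W_eq (v : Plane) :
    W v = (((8 * (halfSin 0 v * halfSin 1 v * halfSin 2 v)) ^ 2 : ℝ) : ℂ) := by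
  have hsum : (⟪v, E 0⟫ : ℝ) + ⟪v, E 1⟫ + ⟪v, E 2⟫ = 0 := by
    rw [← inner_add_right, ← inner_add_right, E_sum, inner_zero_right]
  have hexp : Complex.exp (Complex.I * (((⟪v, E 0⟫ : ℝ) + (⟪v, E 1⟫ : ℝ)) / 2 : ℂ)) *
      Complex.exp (Complex.I * (((⟪v, E 1⟫ : ℝ) + (⟪v, E 2⟫ : ℝ)) / 2 : ℂ)) *
      Complex.exp (Complex.I * (((⟪v, E 2⟫ : ℝ) + (⟪v, E 0⟫ : ℝ)) / 2 : ℂ)) = 1 := by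
    rw [← Complex.exp_add, ← Complex.exp_add, ← Complex.exp_zero]
    congr 1
    have hsum' : ((⟪v, E 0⟫ : ℝ) : ℂ) + (⟪v, E 1⟫ : ℝ) + (⟪v, E 2⟫ : ℝ) = 0 := by
      exact_mod_cast hsum
    linear_combination Complex.I * hsum'
  rw [W, z_sub_z 0 1 0 rfl, z_sub_z 1 2 1 rfl, z_sub_z 2 0 2 rfl]
  generalize Complex.exp (Complex.I * (((⟪v, E 0⟫ : ℝ) + (⟪v, E 1⟫ : ℝ)) / 2 : ℂ)) = x at *
  generalize Complex.exp (Complex.I * (((⟪v, E 1⟫ : ℝ) + (⟪v, E 2⟫ : ℝ)) / 2 : ℂ)) = y at *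
  generalize Complex.exp (Complex.I * (((⟪v, E 2⟫ : ℝ) + (⟪v, E 0⟫ : ℝ)) / 2 : ℂ)) = t at *
  have hI : Complex.I ^ 6 = -1 := by
    rw [show (6 : ℕ) = 2 * 3 from rfl, pow_mul, Complex.I_sq]; norm_num
  push_cast
  calc _ = -(64 * Complex.I ^ 6 *
        ((halfSin 0 v : ℂ) * halfSin 1 v * halfSin 2 v) ^ 2 * (x * y * t) ^ 2) := by ring
    _ = _ := by rw [hexp, hI]; ring

theorem mem_Omega_iff (v : Plane) : v ∈ Omega ↔ ∀ k, halfSin k v ≠ 0 := by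
  rw [Omega, Set.mem_ofPred_eq, W_eq]
  simp [Fin.forall_fin_succ, and_assoc]

theorem fdel_eq {v : Plane} (hv : v ∈ Omega) :
    fdel v = Real.log 64 + ∑ k, 2 * Real.log (halfSin k v) := by
  rw [mem_Omega_iff] at hv
  rw [fdel, W_eq, Complex.ofReal_re, mul_pow, Real.log_mul (by norm_num)
    (by simp [hv]), Real.log_pow (_ * _) 2, Real.log_mul (by simp [hv]) (hv 2),
    Real.log_mul (hv 0) (hv 1), Fin.sum_univ_three]
  rw [show (8 : ℝ) ^ 2 = 64 by norm_num]
  push_cast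
  ring

theorem hasFDerivAt_inner_div_two (k : Fin 3) (v : Plane) :
    HasFDerivAt (fun v : Plane => (⟪V k, v⟫ : ℝ) / 2) ((1 / 2 : ℝ) • innerSL ℝ (V k)) v := by
  have h := (innerSL ℝ (V k)).hasFDerivAt (x := v) |>.const_mul (1 / 2 : ℝ)
  refine h.congr_of_eventuallyEq (.of_forall fun x => ?_)
  simp only [innerSL_apply_apply]
  ring

theorem isOpen_Omega : IsOpen Omega := by
  have h : Omega = ⋂ k, {v | halfSin k v ≠ 0} := by
    ext v
    simp [mem_Omega_iff]
  rw [h]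
  refine isOpen_iInter_of_finite fun k => isOpen_ne_fun ?_ continuous_const
  unfold halfSin
  fun_prop

theorem hasFDerivAt_log_halfSin {k : Fin 3} {v : Plane} (hv : halfSin k v ≠ 0) :
    HasFDerivAt (fun v => 2 * Real.log (halfSin k v))
      (Real.cot (⟪V k, v⟫ / 2) • innerSL ℝ (V k)) v := by
  refine (((hasFDerivAt_inner_div_two k v).sin.log hv).const_mul 2).congr_fderiv ?_
  rw [smul_smul, smul_smul, smul_smul, Real.cot_eq_cos_div_sin]
  ring_nf

theorem hasDerivAt_cot {x : ℝ} (hx : Real.sin x ≠ 0) :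
    HasDerivAt Real.cot (-1 / Real.sin x ^ 2) x := by
  rw [show Real.cot = fun x => Real.cos x / Real.sin x from funext Real.cot_eq_cos_div_sin]
  refine ((Real.hasDerivAt_cos x).div (Real.hasDerivAt_sin x) hx).congr_deriv ?_
  congr 1
  linear_combination -Real.sin_sq_add_cos_sq x

theorem fderiv_fdel {v : Plane} (hv : v ∈ Omega) :
    fderiv ℝ fdel v = ∑ k, Real.cot (⟪V k, v⟫ / 2) • innerSL ℝ (V k) := by
  have h : HasFDerivAt (fun v => Real.log 64 + ∑ k, 2 * Real.log (halfSin k v))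
      (∑ k, Real.cot (⟪V k, v⟫ / 2) • innerSL ℝ (V k)) v :=
    (HasFDerivAt.fun_sum fun k _ =>
      hasFDerivAt_log_halfSin ((mem_Omega_iff v).1 hv k)).const_add _
  refine (h.congr_of_eventuallyEq ?_).fderiv
  filter_upwards [isOpen_Omega.mem_nhds hv] with x hx using fdel_eq hx

theorem Hess_fdel {v : Plane} (hv : v ∈ Omega) (u w : Plane) :
    Hess fdel v u w = ∑ k, -1 / (2 * halfSin k v ^ 2) * ⟪V k, u⟫ * ⟪V k, w⟫ := by
  have h := HasFDerivAt.fun_sum (u := Finset.univ) fun k _ =>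
    ((hasDerivAt_cot ((mem_Omega_iff v).1 hv k)).comp_hasFDerivAt v
      (hasFDerivAt_inner_div_two k v)).smul_const (innerSL ℝ (V k))
  have h' := h.congr_of_eventuallyEq (f₁ := fderiv ℝ fdel) (by
    filter_upwards [isOpen_Omega.mem_nhds hv] with x hx using fderiv_fdel hx)
  rw [Hess, h'.fderiv]
  simp only [sum_apply, ContinuousLinearMap.smulRight_apply,
    smul_apply, innerSL_apply_apply, smul_eq_mul]
  refine Finset.sum_congr rfl fun k _ => ?_
  rw [halfSin, neg_div, neg_div, ← one_div_mul_one_div]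
  ring

/-- On `Ω`, the three coefficients `z_p z_q/(z_p−z_q)²` are real, and the Hessian of
`f = log(Re W)` is `2·Σᵢ (z_p z_q/(z_p−z_q)²)·Vᵢ ⊗ Vᵢ`. -/
theorem deltoid_hessian_formula :
    ∀ v ∈ Omega,
      (∀ i : Fin 3, (cdel i v).im = 0) ∧
      (∀ u w : Plane,
        Hess fdel v u w =
          2 * ((cdel 0 v).re * ⟪V 0, u⟫ * ⟪V 0, w⟫
            + (cdel 1 v).re * ⟪V 1, u⟫ * ⟪V 1, w⟫
            + (cdel 2 v).re * ⟪V 2, u⟫ * ⟪V 2, w⟫)) := by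
  intro v hv
  refine ⟨fun i => by rw [cdel_eq, Complex.ofReal_im], fun u w => ?_⟩
  rw [Hess_fdel hv, Fin.sum_univ_three]
  simp only [cdel_eq, Complex.ofReal_re]
  ring
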